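/- arXiv:2406.09697 — 6 statements merged into one kernel-verified Lean document; each statement's English description precedes it below -/
import Mathlib

section
/- Let n be an even positive integer, let A be the adjacency matrix of a tournament on n players (an n×n integer matrix with entries in {0,1}, zero diagonal, and A + Aᵀ = J − I where J is the all-ones matrix and I the identity), and let S = A − Aᵀ be the corresponding Seidel matrix. Then det S = det(2A + I). -/
open Matrix

/-- A skew-symmetric matrix of odd order has determinant zero. -/
theorem det_eq_zero_of_transpose_eq_neg {m : Type*} [Fintype m] [DecidableEq m]
    (M : Matrix m m ℤ) (hM : Mᵀ = -M) (hm : Odd (Fintype.card m)) : M.det = 0 := by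
  have h : M.det = -M.det := by
    conv_lhs => rw [← det_transpose, hM, det_neg, hm.neg_one_pow, neg_one_mul]
  omega

/-- Adding the symmetric rank-one matrix `C * Cᵀ` to a skew-symmetric matrix of even order
does not change the determinant. -/
theorem det_add_mul_transpose_of_transpose_eq_neg {m : Type*} [Fintype m] [DecidableEq m]
    (S : Matrix m m ℤ) (C : Matrix m Unit ℤ) (hS : Sᵀ = -S) (hm : Even (Fintype.card m)) :
    (S + C * Cᵀ).det = S.det := by
  have hskew : (fromBlocks 0 (-Cᵀ) C S).det = 0 := by
    apply det_eq_zero_of_transpose_eq_neg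
    · simp [fromBlocks_transpose, fromBlocks_neg, hS]
    · simpa [add_comm] using hm.add_one
  have hrow (x : Matrix Unit Unit ℤ) (B : Matrix Unit m ℤ) :
      fromBlocks x B C S = (fromBlocks 0 (-Cᵀ) C S).updateRow (Sum.inl ())
        (Sum.elim (x ()) (B ())) := by
    ext (i | i) (j | j) <;> simp [updateRow_apply]
  have hadd : (fromBlocks 1 (-Cᵀ) C S).det =
      (fromBlocks 0 (-Cᵀ) C S).det + (fromBlocks 1 0 C S).det := by
    rw [hrow 1 (-Cᵀ), hrow 1 0]
    nth_rw 2 [hrow 0 (-Cᵀ)]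
    rw [← det_updateRow_add]
    congr 2
    ext (j | j) <;> simp
  simpa [hskew, det_fromBlocks_one₁₁] using hadd

/-- For a tournament adjacency matrix `A` of even positive order `n`
(entries in `{0,1}`, zero diagonal, `A + Aᵀ = J - I`), the Seidel matrix
`S = A - Aᵀ` satisfies `det S = det (2A + I)`. -/
theorem seidel_det_eq_det_two_smul_add_one (n : ℕ) (hn : 0 < n) (hne : Even n)
    (A : Matrix (Fin n) (Fin n) ℤ)
    (hdiag : ∀ i, A i i = 0)
    (h01 : ∀ i j, A i j = 0 ∨ A i j = 1)
    (htour : A + Aᵀ = Matrix.of (fun _ _ => (1 : ℤ)) - 1) :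
    (A - Aᵀ).det = ((2 : ℤ) • A + 1).det := by
  let C : Matrix (Fin n) Unit ℤ := of fun _ _ => 1
  have hJ : (2 : ℤ) • A + 1 =
      (A - Aᵀ) + C * Cᵀ := by
    ext i j
    have h := congrFun (congrFun htour i) j
    simp [C, mul_apply, -zsmul_eq_mul] at h ⊢
    linarith
  rw [hJ, det_add_mul_transpose_of_transpose_eq_neg]
  · simp
  · simpa using hne
end

section
/- Let S₁ be a Seidel matrix of order m and S₂ a Seidel matrix of order n, and let S be the (m+n)×(m+n) block matrix with diagonal blocks S₁ and S₂, upper-right block the all-ones matrix J, and lower-left block −Jᵀ (the Seidel matrix of the join of the two tournaments). If m is even or n is even, then det S = det S₁ · det S₂. -/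
open Matrix

/-- A Seidel matrix: zero diagonal, off-diagonal entries `±1`, skew-symmetric. -/
def IsSeidel {ι : Type*} (S : Matrix ι ι ℤ) : Prop :=
  (∀ i, S i i = 0) ∧ (∀ i j, i ≠ j → S i j = 1 ∨ S i j = -1) ∧ Sᵀ = -S

/-- Modulo two, a Seidel matrix of even order squares to the identity. -/
lemma IsSeidel.map_zmod_two_mul_self {ι : Type*} [Fintype ι] [DecidableEq ι]
    {S : Matrix ι ι ℤ} (h : IsSeidel S) (hι : Even (Fintype.card ι)) :
    S.map (Int.castRingHom (ZMod 2)) * S.map (Int.castRingHom (ZMod 2)) = 1 := by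
  have hS : S.map (Int.castRingHom (ZMod 2)) = (of fun _ _ => 1) - 1 := by
    ext i j
    rcases eq_or_ne i j with rfl | hij
    · simp [h.1]
    · rcases h.2.1 i j hij with e | e <;> simp [e, hij]
  have hJ : (of fun _ _ => 1 : Matrix ι ι (ZMod 2)) * (of fun _ _ => 1) = 0 := by
    ext i j
    simpa [mul_apply] using (ZMod.natCast_eq_zero_iff_even).2 hι
  have h2 : (of fun _ _ => 1 : Matrix ι ι (ZMod 2)) + (of fun _ _ => 1) = 0 := by
    ext i j
    exact CharTwo.add_self_eq_zero _
  rw [hS, sub_mul, mul_sub, hJ]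
  simp only [mul_one, one_mul]
  rw [zero_sub, neg_sub_left, sub_add_eq_add_sub, h2, zero_sub, neg_neg]

lemma IsSeidel.det_ne_zero {ι : Type*} [Fintype ι] [DecidableEq ι]
    {S : Matrix ι ι ℤ} (h : IsSeidel S) (hι : Even (Fintype.card ι)) : S.det ≠ 0 := by
  intro h0
  have := congrArg det (h.map_zmod_two_mul_self hι)
  rw [det_mul, ← RingHom.mapMatrix_apply, ← RingHom.map_det, h0] at this
  simp at this

lemma ones_mul_mul_ones_eq_zero {ι α β R : Type*} [Fintype ι] [Ring R] [CharZero R]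
    [NoZeroDivisors R] {M : Matrix ι ι R} (hM : Mᵀ = -M) :
    (of fun _ _ => 1 : Matrix α ι R) * M * (of fun _ _ => 1 : Matrix ι β R) = 0 := by
  have hsum : ∑ j, ∑ i, M i j = 0 := by
    refine self_eq_neg.1 ?_
    calc ∑ j, ∑ i, M i j = ∑ i, ∑ j, Mᵀ j i := Finset.sum_comm
      _ = -∑ j, ∑ i, M i j := by rw [hM]; simp
  ext a b
  simpa [mul_apply] using hsum

/-- Bordering a nonsingular skew-symmetric block with all-ones blocks gives a determinant equal to
the product of the determinants of the diagonal blocks. -/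
lemma det_fromBlocks_ones_of_skew {ι κ K : Type*} [Fintype ι] [DecidableEq ι]
    [Fintype κ] [DecidableEq κ] [Field K] [CharZero K] {A : Matrix ι ι K} (hA : Aᵀ = -A)
    (hdet : A.det ≠ 0) (D : Matrix κ κ K) (c d : K) :
    (fromBlocks A (c • of fun _ _ => 1) (d • of fun _ _ => 1) D).det = A.det * D.det := by
  have hu : IsUnit A.det := isUnit_iff_ne_zero.2 hdet
  let := invertibleOfIsUnitDet A hu
  have hinv : (A⁻¹)ᵀ = -A⁻¹ := by
    rw [transpose_nonsing_inv, hA]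
    exact inv_eq_right_inv (by rw [neg_mul_neg, mul_nonsing_inv A hu])
  rw [det_fromBlocks₁₁, invOf_eq_nonsing_inv, Matrix.smul_mul, Matrix.smul_mul, Matrix.mul_smul,
    ones_mul_mul_ones_eq_zero hinv]
  simp

lemma IsSeidel.det_fromBlocks_ones {ι κ : Type*} [Fintype ι] [DecidableEq ι]
    [Fintype κ] [DecidableEq κ] {S : Matrix ι ι ℤ} (h : IsSeidel S)
    (hι : Even (Fintype.card ι)) (D : Matrix κ κ ℤ) (c d : ℤ) :
    (fromBlocks S (c • of fun _ _ => 1) (d • of fun _ _ => 1) D).det = S.det * D.det := by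
  have hskew : (S.map (Int.castRingHom ℚ))ᵀ = -S.map (Int.castRingHom ℚ) := by
    rw [← transpose_map, h.2.2]
    ext i j
    simp
  have hdet : (S.map (Int.castRingHom ℚ)).det ≠ 0 := by
    rw [← RingHom.mapMatrix_apply, ← RingHom.map_det]
    simpa using h.det_ne_zero hι
  have key := det_fromBlocks_ones_of_skew hskew hdet (D.map (Int.castRingHom ℚ)) (c : ℚ) (d : ℚ)
  apply (Int.castRingHom ℚ).injective_int
  rw [map_mul, RingHom.map_det, RingHom.map_det, RingHom.map_det]
  simp only [RingHom.mapMatrix_apply]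
  rw [← key, fromBlocks_map]
  congr 2 <;> ext i j <;> simp

/-- the determinant of the Seidel matrix of a join of two tournaments,
at least one of even order, is the product of the two determinants. -/
theorem det_seidel_join (m n : ℕ)
    (S₁ : Matrix (Fin m) (Fin m) ℤ) (S₂ : Matrix (Fin n) (Fin n) ℤ)
    (h₁ : IsSeidel S₁) (h₂ : IsSeidel S₂) (hpar : Even m ∨ Even n) :
    (Matrix.fromBlocks S₁ (Matrix.of fun _ _ => (1 : ℤ))
        (-(Matrix.of fun _ _ => (1 : ℤ))ᵀ) S₂).det = S₁.det * S₂.det := by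
  rcases hpar with hm | hn
  · rw [← h₁.det_fromBlocks_ones (by simpa using hm) S₂ 1 (-1)]
    congr 2
  · rw [mul_comm, ← h₂.det_fromBlocks_ones (by simpa using hn) S₁ (-1) 1,
      ← det_submatrix_equiv_self (Equiv.sumComm (Fin m) (Fin n))]
    congr 1
    ext (i | i) (j | j) <;> simp
end

section
/- Let S be an invertible Seidel matrix of order n (viewed over the rationals), let i ≠ j be indices with S i j = 1, and let S' be the matrix that agrees with S in every entry except S' i j = −1 and S' j i = 1. Then det S' = det S · (1 + 2·(S⁻¹) i j)². -/
open Matrix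

/-- A Seidel matrix over ℚ: zero diagonal, off-diagonal entries `±1`, skew-symmetric. -/
def IsSeidelQ {n : ℕ} (S : Matrix (Fin n) (Fin n) ℚ) : Prop :=
  (∀ i, S i i = 0) ∧ (∀ i j, i ≠ j → S i j = 1 ∨ S i j = -1) ∧ Sᵀ = -S

/-- The determinant of a rank-two perturbation of an invertible matrix at the entries `(i, j)` and
`(j, i)`. -/
theorem Matrix.det_add_single_add_single {n R : Type*} [Fintype n] [DecidableEq n] [CommRing R]
    {A : Matrix n n R} (hA : IsUnit A.det) (i j : n) (a b : R) :
    (A + (single i j a + single j i b)).det =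
      A.det * ((1 + a * A⁻¹ j i) * (1 + b * A⁻¹ i j) - a * b * A⁻¹ i i * A⁻¹ j j) := by
  let U : Matrix n (Fin 2) R :=
    Matrix.of fun k => ![(Pi.single i a : n → R) k, (Pi.single j b : n → R) k]
  let V : Matrix (Fin 2) n R := Matrix.of ![Pi.single j 1, Pi.single i 1]
  have hUV : single i j a + single j i b = U * V := by
    ext k l
    simp only [U, V, Matrix.add_apply, single_apply, mul_apply, Fin.sum_univ_two, of_apply,
      cons_val_zero, cons_val_one, Pi.single_apply]
    grind
  have hVU : V * A⁻¹ * U = !![A⁻¹ j i * a, A⁻¹ j j * b; A⁻¹ i i * a, A⁻¹ i j * b] := by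
    ext p q
    fin_cases p <;> fin_cases q <;> simp [U, V, mul_apply, Pi.single_apply]
  rw [hUV, det_add_mul _ _ hA, hVU, one_fin_two, det_fin_two]
  simp
  ring

/-- The inverse of a skew-symmetric matrix is skew-symmetric. -/
theorem Matrix.transpose_inv_of_transpose_eq_neg {n R : Type*} [Fintype n] [DecidableEq n]
    [CommRing R] {A : Matrix n n R} (hA : IsUnit A.det) (h : Aᵀ = -A) : (A⁻¹)ᵀ = -A⁻¹ := by
  rw [transpose_nonsing_inv, h]
  exact inv_eq_left_inv (by rw [neg_mul_neg, nonsing_inv_mul _ hA])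

/-- determinant of the Seidel matrix of an `(i,j)`-arc-reversal:
if `S` is invertible with `S i j = 1` and `S'` is obtained from `S` by replacing
the `(i,j)` entry by `-1` and the `(j,i)` entry by `1`, then
`det S' = det S · (1 + 2 (S⁻¹) i j)²`. -/
theorem det_reversal (n : ℕ) (S : Matrix (Fin n) (Fin n) ℚ)
    (hS : IsSeidelQ S) (hdet : S.det ≠ 0)
    (i j : Fin n) (hij : i ≠ j) (hone : S i j = 1)
    (S' : Matrix (Fin n) (Fin n) ℚ)
    (hS' : S' = Matrix.of fun k l =>
      if k = i ∧ l = j then -1 else if k = j ∧ l = i then 1 else S k l) :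
    S'.det = S.det * (1 + 2 * (S⁻¹ i j)) ^ 2 := by
  have hu : IsUnit S.det := isUnit_iff_ne_zero.mpr hdet
  have hskew : ∀ k l, S l k = -S k l := fun k l => congrFun (congrFun hS.2.2 k) l
  have hinv : ∀ k l, S⁻¹ l k = -S⁻¹ k l := fun k l =>
    congrFun (congrFun (transpose_inv_of_transpose_eq_neg hu hS.2.2) k) l
  have hdiag : S⁻¹ i i = 0 := self_eq_neg.mp (hinv i i)
  have hpert : S' = S + (single i j (-2) + single j i 2) := by
    have hji := hskew i j
    subst hS'
    ext k l
    simp only [of_apply, Matrix.add_apply, single_apply]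
    grind
  rw [hpert, det_add_single_add_single hu, hinv i j, hdiag]
  ring
end

section
/- Let n be an even positive integer and let Rₙ be the Seidel matrix of the transitive tournament of order n. Then det Rₙ = 1, and the inverse of Rₙ is the n×n matrix M with M i i = 0, M i j = (−1)^(j−i) for i < j, and M i j = −(−1)^(i−j) for i > j; that is, Rₙ · M = I. -/
open Matrix

/-- Closed form of the partial alternating sums of the products `sgn (k - i) * sgn (j - k)`. -/
theorem two_mul_alternating_sum_sign_mul_sign (i j m : ℕ) :
    2 * ∑ k ∈ Finset.range m, (if i < k then (1 : ℤ) else if k < i then -1 else 0) *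
      ((if k < j then 1 else if j < k then -1 else 0) * (-1) ^ k) =
    if m ≤ i ∧ m ≤ j then (-1) ^ m - 1
    else if m ≤ i ∨ m ≤ j then -1 - (-1) ^ m
    else (-1) ^ m - 1 + if i = j then 2 * (-1) ^ i else 0 := by
  induction m with
  | zero => simp
  | succ m ih =>
    rw [Finset.sum_range_succ, mul_add, ih, pow_succ]
    rcases lt_trichotomy m i with h | rfl | h <;> rcases lt_trichotomy m j with h' | rfl | h' <;>
      grind

/-- The entries `± (-1) ^ |i - j|` as a sign matrix with alternating row and column scalings. -/
theorem ite_neg_one_pow_sub_eq_sign_mul (k j : ℕ) :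
    (if k < j then (-1 : ℤ) ^ (j - k) else if j < k then -((-1 : ℤ) ^ (k - j)) else 0) =
    (if k < j then 1 else if j < k then -1 else 0) * (-1) ^ k * (-1) ^ j := by
  have key {a b : ℕ} (h : a < b) : (-1 : ℤ) ^ (b - a) = (-1) ^ a * (-1) ^ b := by
    obtain ⟨d, rfl⟩ := Nat.exists_eq_add_of_lt h
    rw [← pow_add, show a + d + 1 - a = d + 1 by lia,
      show a + (a + d + 1) = 2 * a + (d + 1) by ring, pow_add _ (2 * a), pow_mul]
    simp
  rcases lt_trichotomy k j with h | rfl | h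
  · simp [h, key h]
  · simp
  · simp [h, h.not_gt, key h, mul_comm]

/-- for even positive `n`, the Seidel matrix `Rₙ` of the transitive
tournament has determinant `1`, and its inverse is the matrix `M` with
`M i i = 0`, `M i j = (-1)^(j-i)` for `i < j` and `M i j = -(-1)^(i-j)` for `i > j`. -/
theorem transitive_seidel_det_and_inverse (n : ℕ) (hn : 0 < n) (hne : Even n)
    (R M : Matrix (Fin n) (Fin n) ℤ)
    (hR : R = Matrix.of fun i j =>
      if i < j then 1 else if j < i then -1 else 0)
    (hM : M = Matrix.of fun (i j : Fin n) =>
      if i < j then (-1 : ℤ) ^ ((j : ℕ) - (i : ℕ))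
      else if j < i then -((-1 : ℤ) ^ ((i : ℕ) - (j : ℕ)))
      else 0) :
    R.det = 1 ∧ R * M = 1 := by
  have hRM : R * M = 1 := by
    ext i j
    have h := two_mul_alternating_sum_sign_mul_sign i j n
    rw [← Fin.sum_univ_eq_sum_range (fun k => (if (i : ℕ) < k then (1 : ℤ) else
      if k < i then -1 else 0) * ((if k < j then 1 else if (j : ℕ) < k then -1 else 0) *
      (-1) ^ k)) n] at h
    simp only [i.isLt.not_ge, j.isLt.not_ge, hne.neg_one_pow, false_and, false_or,
      if_false, sub_self, zero_add] at h
    simp only [hR, hM, Matrix.mul_apply, Matrix.of_apply, Matrix.one_apply, Fin.lt_def,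
      ite_neg_one_pow_sub_eq_sign_mul, Fin.ext_iff, ← mul_assoc, ← Finset.sum_mul] at h ⊢
    split_ifs at h ⊢ with hij
    · rw [mul_left_cancel₀ two_ne_zero h, hij, ← pow_add, Even.neg_one_pow ⟨_, rfl⟩]
    · rw [(mul_eq_zero_iff_left two_ne_zero).1 h, zero_mul]
  refine ⟨?_, hRM⟩
  let u : Fin n → ℤ := fun _ => 1
  have hskew : Mᵀ = -M := by
    ext i j
    simp only [hM, Matrix.transpose_apply, Matrix.neg_apply, Matrix.of_apply]
    rcases lt_trichotomy i j with h | rfl | h <;> simp [*, not_lt_of_gt]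
  have hquad : u ⬝ᵥ (M *ᵥ u) = 0 := by
    have h : u ⬝ᵥ (M *ᵥ u) = -(u ⬝ᵥ (M *ᵥ u)) := by
      conv_lhs => rw [dotProduct_mulVec, ← mulVec_transpose, hskew, neg_mulVec, neg_dotProduct,
        dotProduct_comm]
    lia
  have hfactor : R + vecMulVec u u = R * (1 + vecMulVec (M *ᵥ u) u) := by
    rw [mul_add, mul_one, mul_vecMulVec, mulVec_mulVec, hRM, one_mulVec]
  have htri : (R + vecMulVec u u).det = 1 := by
    rw [det_of_isUpperTriangular]
    · simp [hR, vecMulVec_apply, u]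
    · intro i j hij
      have hij' : j < i := hij
      simp [hR, vecMulVec_apply, u, hij', hij'.not_gt]
  rwa [hfactor, det_mul, vecMulVec_eq Unit, det_one_add_replicateCol_mul_replicateRow, hquad,
    add_zero, mul_one] at htri
end

section
/- Let n be an even positive integer. The sum of det S over all Seidel matrices S of order n equals (n−1)!! · 2^(n(n−1)/2). Equivalently, the expected value of the determinant of a Seidel matrix of order n chosen uniformly at random is the double factorial (n−1)!!. -/
open Matrix BigOperators

/-- The Seidel matrix of order `n` determined by a choice of sign for each
pair `i < j`:  the `(i,j)` entry, for `i < j`, is `1` if `ε` is `true` on the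
pair and `-1` otherwise; entries below the diagonal are determined by
skew-symmetry.  This is a bijective parametrization of the `2^(n(n-1)/2)`
Seidel matrices of order `n`. -/
def seidelOfSigns (n : ℕ) (ε : {p : Fin n × Fin n // p.1 < p.2} → Bool) :
    Matrix (Fin n) (Fin n) ℤ :=
  Matrix.of fun i j =>
    if h : i < j then (if ε ⟨(i, j), h⟩ then 1 else -1)
    else if h' : j < i then -(if ε ⟨(j, i), h'⟩ then 1 else -1)
    else 0

/-- The number of pairs `i < j` in `Fin n`. -/
lemma card_fin_pairs_lt (n : ℕ) :
    Fintype.card {p : Fin n × Fin n // p.1 < p.2} = n * (n - 1) / 2 := by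
  rw [Fintype.card_subtype, Finset.card_filter, Fintype.sum_prod_type_right]
  simp only [← Finset.card_filter]
  rw [← Finset.sum_range_id, ← Fin.sum_univ_eq_sum_range]
  refine Finset.sum_congr rfl fun j _ => ?_
  rw [← Fin.card_Iio j]
  congr 1
  ext i
  simp

lemma seidelOfSigns_apply_self (n : ℕ) (ε : {p : Fin n × Fin n // p.1 < p.2} → Bool) (i : Fin n) :
    seidelOfSigns n ε i i = 0 := by
  simp [seidelOfSigns]

lemma seidelOfSigns_swap (n : ℕ) (ε : {p : Fin n × Fin n // p.1 < p.2} → Bool) (i j : Fin n) :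
    seidelOfSigns n ε j i = -seidelOfSigns n ε i j := by
  rcases lt_trichotomy i j with h | rfl | h
  · simp [seidelOfSigns, h, h.not_gt]
  · simp [seidelOfSigns]
  · simp [seidelOfSigns, h, h.not_gt]

lemma seidelOfSigns_mul_self (n : ℕ) (ε : {p : Fin n × Fin n // p.1 < p.2} → Bool) {i j : Fin n}
    (h : i ≠ j) : seidelOfSigns n ε i j * seidelOfSigns n ε i j = 1 := by
  simp only [seidelOfSigns, Matrix.of_apply]
  rcases h.lt_or_gt with h | h
  · simp only [h, dif_pos]; split_ifs <;> norm_num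
  · simp only [h, h.not_gt, dif_pos, dif_neg, not_false_eq_true]; split_ifs <;> norm_num

/-- Flipping the sign attached to one coordinate. -/
def flipSign {ι : Type*} [DecidableEq ι] (p : ι) : Equiv.Perm (ι → Bool) :=
  Function.Involutive.toPerm (fun ε => Function.update ε p (!ε p)) fun ε => by simp

lemma flipSign_apply {ι : Type*} [DecidableEq ι] (p q : ι) (ε : ι → Bool) :
    flipSign p ε q = if q = p then !ε q else ε q := by
  change Function.update ε p (!ε p) q = _
  rcases eq_or_ne q p with rfl | h <;> simp [*]

/-- Flipping the sign of a pair negates the two corresponding entries of the Seidel matrix. -/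
lemma seidelOfSigns_flipSign (n : ℕ) (ε : {p : Fin n × Fin n // p.1 < p.2} → Bool)
    (p : {p : Fin n × Fin n // p.1 < p.2}) (i j : Fin n) :
    seidelOfSigns n (flipSign p ε) i j =
      (if s(i, j) = s(p.1.1, p.1.2) then -1 else 1) * seidelOfSigns n ε i j := by
  obtain ⟨⟨a, b⟩, hab⟩ := p
  have hab' : a < b := hab
  simp only [seidelOfSigns, Matrix.of_apply, flipSign_apply, Subtype.mk.injEq, Prod.mk.injEq,
    Sym2.eq_iff]
  rcases lt_trichotomy i j with h | rfl | h
  · have : ¬(i = b ∧ j = a) := by rintro ⟨rfl, rfl⟩; exact h.not_gt hab'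
    rw [dif_pos h, dif_pos h]
    by_cases h1 : i = a ∧ j = b <;> cases ε ⟨(i, j), h⟩ <;> simp only [h1, this] <;> simp
  · simp
  · have : ¬(i = a ∧ j = b) := by rintro ⟨rfl, rfl⟩; exact h.not_gt hab'
    rw [dif_neg h.not_gt, dif_neg h.not_gt, dif_pos h, dif_pos h]
    simp only [and_comm (a := j = a)]
    by_cases h1 : i = b ∧ j = a <;> cases ε ⟨(j, i), h⟩ <;> simp only [h1, this] <;> simp

/-- The pair of distinct indices `i`, `j`, in increasing order. -/
lemma exists_pair_eq {n : ℕ} {i j : Fin n} (h : i ≠ j) :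
    ∃ p : {p : Fin n × Fin n // p.1 < p.2}, s(p.1.1, p.1.2) = s(i, j) := by
  rcases h.lt_or_gt with h | h
  · exact ⟨⟨(i, j), h⟩, rfl⟩
  · exact ⟨⟨(j, i), h⟩, Sym2.eq_swap⟩

/-- A permutation that is not an involution contributes nothing to the sum of determinants. -/
lemma sum_prod_seidelOfSigns_eq_zero (n : ℕ) (σ : Equiv.Perm (Fin n)) {a : Fin n}
    (ha : σ (σ a) ≠ a) :
    ∑ ε : ({p : Fin n × Fin n // p.1 < p.2} → Bool), ∏ i, seidelOfSigns n ε (σ i) i = 0 := by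
  have hσa : σ a ≠ a := fun h => ha (by rw [h, h])
  obtain ⟨p, hp⟩ := exists_pair_eq hσa
  have hiff (i : Fin n) : s(σ i, i) = s(p.1.1, p.1.2) ↔ i = a := by
    rw [hp, Sym2.eq_iff]
    constructor
    · rintro (⟨-, h⟩ | ⟨h, rfl⟩)
      · exact h
      · exact absurd h ha
    · rintro rfl
      exact Or.inl ⟨rfl, rfl⟩
  have key := Equiv.sum_comp (flipSign p) fun ε => ∏ i, seidelOfSigns n ε (σ i) i
  simp only [seidelOfSigns_flipSign, hiff, Finset.prod_mul_distrib, Finset.prod_ite_eq',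
    Finset.mem_univ, if_true, ← Finset.mul_sum] at key
  linarith

/-- A fixed-point-free involution of a linear order moves exactly half of the points up. -/
lemma two_mul_card_filter_lt {α : Type*} [LinearOrder α] [Fintype α] (σ : Equiv.Perm α)
    (hσ : ∀ i, σ (σ i) = i) (hfix : ∀ i, σ i ≠ i) :
    2 * (Finset.univ.filter fun i => i < σ i).card = Fintype.card α := by
  have h : (Finset.univ.filter fun i => i < σ i).card =
      (Finset.univ.filter fun i => ¬ i < σ i).card :=
    Finset.card_bij' (fun i _ => σ i) (fun i _ => σ i)
      (fun i hi => by simpa [hσ] using (Finset.mem_filter.1 hi).2.le)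
      (fun i hi => by
        simpa [hσ] using lt_of_le_of_ne (not_lt.1 (Finset.mem_filter.1 hi).2) (hfix i))
      (fun i _ => hσ i) (fun i _ => hσ i)
  rw [two_mul]
  nth_rw 2 [h]
  exact Finset.card_filter_add_card_filter_not _

/-- The product of the entries of a Seidel matrix along a fixed-point-free involution. -/
lemma prod_seidelOfSigns_of_involutive (n : ℕ) (ε : {p : Fin n × Fin n // p.1 < p.2} → Bool)
    (σ : Equiv.Perm (Fin n)) (hσ : ∀ i, σ (σ i) = i) (hfix : ∀ i, σ i ≠ i) :
    ∏ i, seidelOfSigns n ε (σ i) i = (-1) ^ (n / 2) := by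
  have h : ∏ i ∈ Finset.univ.filter (fun i => ¬ i < σ i), seidelOfSigns n ε (σ i) i =
      ∏ i ∈ Finset.univ.filter (fun i => i < σ i), seidelOfSigns n ε i (σ i) :=
    Finset.prod_bij' (fun i _ => σ i) (fun i _ => σ i)
      (fun i hi => by
        simpa [hσ] using lt_of_le_of_ne (not_lt.1 (Finset.mem_filter.1 hi).2) (hfix i))
      (fun i hi => by simpa [hσ] using (Finset.mem_filter.1 hi).2.le)
      (fun i _ => hσ i) (fun i _ => hσ i) (fun i _ => by simp [hσ])
  rw [← Finset.prod_filter_mul_prod_filter_not Finset.univ (fun i => i < σ i), h,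
    ← Finset.prod_mul_distrib]
  have hterm (i : Fin n) : seidelOfSigns n ε (σ i) i * seidelOfSigns n ε i (σ i) = -1 := by
    rw [seidelOfSigns_swap n ε i (σ i), neg_mul, seidelOfSigns_mul_self n ε (hfix i).symm]
  simp only [hterm, Finset.prod_const]
  have := two_mul_card_filter_lt σ hσ hfix
  rw [Fintype.card_fin] at this
  congr 1
  omega

/-- Fixed-point-free involutions are the products of disjoint transpositions covering all points. -/
lemma cycleType_eq_replicate_two_iff {α : Type*} [Fintype α] [DecidableEq α]
    (hα : Even (Fintype.card α)) (σ : Equiv.Perm α) :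
    σ.cycleType = Multiset.replicate (Fintype.card α / 2) 2 ↔
      (∀ i, σ (σ i) = i) ∧ ∀ i, σ i ≠ i := by
  have hsq : σ ^ 2 = 1 ↔ ∀ i, σ (σ i) = i := by
    simp [Equiv.ext_iff, sq]
  have hfix : σ.support.card = Fintype.card α ↔ ∀ i, σ i ≠ i := by
    rw [Finset.card_eq_iff_eq_univ, Finset.eq_univ_iff_forall]
    simp
  rw [← hsq, ← hfix, ← Equiv.Perm.sum_cycleType]
  constructor
  · intro h
    refine ⟨Equiv.Perm.pow_prime_eq_one_iff.2 fun c hc => ?_, ?_⟩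
    · exact Multiset.eq_of_mem_replicate (h ▸ hc)
    · rw [h, Multiset.sum_replicate, smul_eq_mul]
      exact Nat.div_mul_cancel hα.two_dvd
  · rintro ⟨h1, h2⟩
    have h := Equiv.Perm.cycleType_of_pow_prime_eq_one h1
    rw [h, Multiset.sum_replicate, smul_eq_mul] at h2
    rw [h, ← h2, Nat.mul_div_cancel _ two_pos]

lemma sign_of_cycleType_eq_replicate_two {α : Type*} [Fintype α] [DecidableEq α]
    {σ : Equiv.Perm α} {m : ℕ} (h : σ.cycleType = Multiset.replicate m 2) :
    Equiv.Perm.sign σ = (-1) ^ m := by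
  simp [Equiv.Perm.sign_of_cycleType', h]

/-- The number of fixed-point-free involutions of a set with `2 * (m + 1)` elements. -/
lemma card_cycleType_eq_replicate_two {α : Type*} [Fintype α] [DecidableEq α] {m : ℕ}
    (hα : Fintype.card α = 2 * (m + 1)) :
    (Finset.univ.filter fun σ : Equiv.Perm α =>
      σ.cycleType = Multiset.replicate (m + 1) 2).card = Nat.doubleFactorial (2 * m + 1) := by
  have h := Equiv.Perm.card_of_cycleType_mul_eq α (Multiset.replicate (m + 1) 2)
  rw [if_pos ⟨by rw [hα, Multiset.sum_replicate, smul_eq_mul, mul_comm], fun a ha => (Multiset.eq_of_mem_replicate ha).ge⟩] at h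
  have hfac : Nat.factorial (2 * (m + 1)) =
      Nat.doubleFactorial (2 * m + 1) * (2 ^ (m + 1) * Nat.factorial (m + 1)) := by
    rw [← Nat.doubleFactorial_two_mul, Nat.mul_comm (Nat.doubleFactorial _)]
    rw [mul_add_one, Nat.factorial_eq_mul_doubleFactorial, mul_comm]
  rw [hα, hfac, Multiset.toFinset_replicate, if_neg (Nat.succ_ne_zero m)] at h
  simp only [Multiset.sum_replicate, smul_eq_mul, mul_comm (m + 1) 2, Nat.sub_self,
    Nat.factorial_zero, one_mul, Multiset.prod_replicate, Finset.prod_singleton,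
    Multiset.count_replicate_self] at h
  exact Nat.eq_of_mul_eq_mul_right (by positivity) h

/-- The contribution of one permutation to the sum of determinants. -/
lemma sum_sign_mul_prod_seidelOfSigns {n : ℕ} (hn : Even n) (σ : Equiv.Perm (Fin n)) :
    ∑ ε : ({p : Fin n × Fin n // p.1 < p.2} → Bool),
        (Equiv.Perm.sign σ : ℤ) * ∏ i, seidelOfSigns n ε (σ i) i =
      if σ.cycleType = Multiset.replicate (n / 2) 2 then 2 ^ (n * (n - 1) / 2) else 0 := by
  have hiff := cycleType_eq_replicate_two_iff (by simpa using hn) σ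
  rw [Fintype.card_fin] at hiff
  split_ifs with h
  · obtain ⟨hσ, hfix⟩ := hiff.1 h
    simp only [prod_seidelOfSigns_of_involutive n _ σ hσ hfix,
      sign_of_cycleType_eq_replicate_two h]
    simp [← mul_pow, card_fin_pairs_lt]
  · rw [← Finset.mul_sum]
    by_cases hσ : ∀ i, σ (σ i) = i
    · obtain ⟨a, ha⟩ : ∃ a, σ a = a := by
        by_contra! hfix
        exact h (hiff.2 ⟨hσ, hfix⟩)
      have hzero (ε : {p : Fin n × Fin n // p.1 < p.2} → Bool) :
          ∏ i, seidelOfSigns n ε (σ i) i = 0 :=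
        Finset.prod_eq_zero (Finset.mem_univ a) (by rw [ha, seidelOfSigns_apply_self])
      simp [hzero]
    · push Not at hσ
      obtain ⟨a, ha⟩ := hσ
      rw [sum_prod_seidelOfSigns_eq_zero n σ ha, mul_zero]

/-- for even positive `n`, the sum of `det S` over all Seidel
matrices `S` of order `n` is `(n-1)‼ · 2^(n(n-1)/2)`; equivalently the expected
determinant of a uniformly random Seidel matrix of order `n` is `(n-1)‼`. -/
theorem expected_det_seidel (n : ℕ) (hn : 0 < n) (hne : Even n) :
    ∑ ε : ({p : Fin n × Fin n // p.1 < p.2} → Bool), (seidelOfSigns n ε).det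
      = (Nat.doubleFactorial (n - 1) : ℤ) * 2 ^ (n * (n - 1) / 2) := by
  obtain ⟨m, rfl⟩ : ∃ m, n = 2 * (m + 1) := by
    obtain ⟨k, rfl⟩ := hne
    exact ⟨k - 1, by omega⟩
  simp only [Matrix.det_apply', Int.cast_id]
  rw [Finset.sum_comm]
  simp only [sum_sign_mul_prod_seidelOfSigns hne]
  rw [← Finset.sum_filter, Finset.sum_const, nsmul_eq_mul, Nat.mul_div_cancel_left _ two_pos,
    card_cycleType_eq_replicate_two (Fintype.card_fin _)]
  rfl
end

section
/- For every real constant c > 0 there exists N such that for all n > N and all natural numbers k with (k : ℝ) ≥ n/c, the Seidel matrix R_k of the transitive tournament of order k is not a principal submatrix of any skew-conference matrix of order n; that is, there is no skew-conference matrix S of order n and injective map f from {1,…,k} to {1,…,n} with S (f i) (f j) = (R_k) i j for all i, j. -/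
open Matrix

/-- A skew-conference matrix of order `n`: zero diagonal, off-diagonal entries
`±1`, skew-symmetric, and `S·Sᵀ = (n-1)·I`. -/
def IsSkewConference {n : ℕ} (S : Matrix (Fin n) (Fin n) ℤ) : Prop :=
  (∀ i, S i i = 0) ∧ (∀ i j, i ≠ j → S i j = 1 ∨ S i j = -1) ∧ Sᵀ = -S ∧
    S * Sᵀ = ((n : ℤ) - 1) • (1 : Matrix (Fin n) (Fin n) ℤ)

/-- The Seidel matrix of the transitive tournament of order `k`. -/
def transSeidel (k : ℕ) : Matrix (Fin k) (Fin k) ℤ :=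
  Matrix.of fun i j => if i < j then 1 else if j < i then -1 else 0

theorem sum_range_tournament_sign (b m : ℕ) :
    ∑ a ∈ Finset.range m, (if a < b then (1 : ℤ) else if b < a then -1 else 0) =
      if m ≤ b then (m : ℤ) else 2 * b + 1 - m := by
  induction m with
  | zero => simp
  | succ m ih =>
    rw [Finset.sum_range_succ, ih]
    split_ifs <;> push_cast <;> omega

theorem sum_transSeidel_column {k : ℕ} (b : Fin k) :
    ∑ a, transSeidel k a b = 2 * (b : ℤ) + 1 - k := by
  have h := sum_range_tournament_sign b k
  rw [if_neg (by omega), Finset.sum_range] at h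
  exact h

theorem three_mul_sum_range_sq (c : ℤ) (m : ℕ) :
    3 * ∑ b ∈ Finset.range m, (2 * (b : ℤ) + 1 - c) ^ 2 =
      2 * (m - 1) * m * (2 * m - 1) + 6 * m * (m - 1) * (1 - c) + 3 * m * (1 - c) ^ 2 := by
  induction m with
  | zero => simp
  | succ m ih =>
    rw [Finset.sum_range_succ, mul_add, ih]
    push_cast
    ring

theorem three_mul_sum_transSeidel_column_sq (k : ℕ) :
    3 * ∑ b, (∑ a, transSeidel k a b) ^ 2 = (k : ℤ) * (k ^ 2 - 1) := by
  simp_rw [sum_transSeidel_column]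
  have h := three_mul_sum_range_sq k k
  rw [Finset.sum_range] at h
  rw [h]
  ring

theorem IsSkewConference.sum_sq_sum_rows {n k : ℕ} {S : Matrix (Fin n) (Fin n) ℤ}
    (hS : IsSkewConference S) {f : Fin k → Fin n} (hf : Function.Injective f) :
    ∑ j, (∑ a, S (f a) j) ^ 2 = ((n : ℤ) - 1) * k := by
  have hrow : ∀ i i', ∑ j, S i j * S i' j = if i = i' then (n : ℤ) - 1 else 0 := fun i i' => by
    simpa [mul_apply, one_apply] using congrFun (congrFun hS.2.2.2 i) i'
  simp_rw [sq, Finset.sum_mul_sum]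
  rw [Finset.sum_comm]
  simp_rw [Finset.sum_comm (s := Finset.univ (α := Fin n)), hrow, hf.eq_iff]
  simp only [Finset.sum_ite_eq, Finset.mem_univ, if_true, Finset.sum_const, Finset.card_univ,
    Fintype.card_fin, nsmul_eq_mul]
  ring

/-- A transitive principal submatrix of a skew-conference matrix has order `O(√n)`: compare the
norm of the sum of its rows with the norm of the sum of the corresponding rows of `S`. -/
theorem IsSkewConference.sq_order_le {n k : ℕ} {S : Matrix (Fin n) (Fin n) ℤ}
    (hS : IsSkewConference S) {f : Fin k → Fin n} (hf : Function.Injective f)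
    (hfS : ∀ i j, S (f i) (f j) = transSeidel k i j) (hk : 0 < k) :
    k ^ 2 + 2 ≤ 3 * n := by
  have hle : ∑ b, (∑ a, transSeidel k a b) ^ 2 ≤ ∑ j, (∑ a, S (f a) j) ^ 2 := by
    simp_rw [← hfS]
    rw [← Finset.sum_image (s := Finset.univ) (g := f) (f := fun j => (∑ a, S (f a) j) ^ 2)
      hf.injOn]
    exact Finset.sum_le_sum_of_subset_of_nonneg (Finset.subset_univ _)
      fun _ _ _ => sq_nonneg _
  rw [hS.sum_sq_sum_rows hf] at hle
  have hsum := three_mul_sum_transSeidel_column_sq k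
  have hk' : (0 : ℤ) < k := by exact_mod_cast hk
  have hmul : (k : ℤ) * (k ^ 2 - 1) ≤ k * (3 * (n - 1)) := by linarith
  have hdiv := le_of_mul_le_mul_left hmul hk'
  zify
  linarith

/-- for every `c > 0` there is an `N` such that for all `n > N`
and all `k` with `k ≥ n/c`, the transitive Seidel matrix `R_k` is not a
principal submatrix of any skew-conference matrix of order `n`. -/
theorem transitive_not_principal_submatrix_of_skew_conference :
    ∀ c : ℝ, 0 < c → ∃ N : ℕ, ∀ n : ℕ, N < n → ∀ k : ℕ, (n : ℝ) / c ≤ (k : ℝ) →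
      ¬ ∃ (S : Matrix (Fin n) (Fin n) ℤ) (f : Fin k → Fin n),
          IsSkewConference S ∧ Function.Injective f ∧
          ∀ i j : Fin k, S (f i) (f j) = transSeidel k i j := by
  intro c hc
  obtain ⟨N, hN⟩ := exists_nat_gt (3 * c ^ 2)
  refine ⟨N, fun n hn k hk => ?_⟩
  rintro ⟨S, f, hS, hf, hfS⟩
  have hnN : (N : ℝ) < n := by exact_mod_cast hn
  have hn0 : (0 : ℝ) < n := N.cast_nonneg.trans_lt hnN
  have hk0 : 0 < k := by exact_mod_cast (div_pos hn0 hc).trans_le hk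
  have hbound : (k : ℝ) ^ 2 + 2 ≤ 3 * n := by exact_mod_cast hS.sq_order_le hf hfS hk0
  rw [div_le_iff₀ hc] at hk
  have hsq : (n : ℝ) * n ≤ n * (3 * c ^ 2) := by
    calc (n : ℝ) * n ≤ (k * c) * (k * c) := mul_self_le_mul_self hn0.le hk
      _ = k ^ 2 * c ^ 2 := by ring
      _ ≤ (3 * n) * c ^ 2 := by gcongr; linarith
      _ = n * (3 * c ^ 2) := by ring
  linarith [le_of_mul_le_mul_left hsq hn0]
end
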